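/- Let ω ≥ 0 satisfy ω ∈ L¹(Π) ∩ L²(Π) and x₂ω ∈ L¹(Π). Then there exists a nonnegative function ω* on Π that is Steiner symmetric in x₁ and satisfies: ‖ω*‖_{L^s(Π)} = ‖ω‖_{L^s(Π)} for every s ∈ [1,2], ‖x₂ω*‖_{L¹(Π)} = ‖x₂ω‖_{L¹(Π)}, and E(ω*) ≥ E(ω). -/

import Mathlib

open MeasureTheory Real Filter

noncomputable section

/-- The upper half plane `Π = {x ∈ ℝ² : x₂ > 0}`. -/
def UHP : Set (ℝ × ℝ) := {x | 0 < x.2}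

/-- Euclidean norm of a point of `ℝ²`. -/
def rad (x : ℝ × ℝ) : ℝ := Real.sqrt (x.1 ^ 2 + x.2 ^ 2)

/-- Modified Bessel function of the second kind of order `0`:
`K₀(r) = ∫₀^∞ exp(-r cosh t) dt`. -/
def K0 (r : ℝ) : ℝ := ∫ t in Set.Ioi (0 : ℝ), Real.exp (-(r * Real.cosh t))

/-- Fundamental solution `G(x,y) = (1/2π) K₀(|x-y|)` of `−Δ + Id` on `ℝ²`. -/
def Gker (x y : ℝ × ℝ) : ℝ := (1 / (2 * Real.pi)) * K0 (rad (x - y))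

/-- Reflection `x̄ = (x₁, −x₂)` across the `x₁`-axis. -/
def reflPt (x : ℝ × ℝ) : ℝ × ℝ := (x.1, -x.2)

/-- Green's function `G_Π(x,y) = G(x,y) − G(x̄,y)` of `−Δ + Id` on the half plane. -/
def GUHP (x y : ℝ × ℝ) : ℝ := Gker x y - Gker (reflPt x) y

/-- The operator `𝒢ω(x) = ∫_Π G_Π(x,y) ω(y) dy`. -/
def Gop (ω : ℝ × ℝ → ℝ) (x : ℝ × ℝ) : ℝ := ∫ y in UHP, GUHP x y * ω y

/-- Kinetic energy `E(ω) = (1/2) ∫_Π ω 𝒢ω`. -/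
def kineticE (ω : ℝ × ℝ → ℝ) : ℝ := (1 / 2) * ∫ x in UHP, ω x * Gop ω x

/-- Impulse `I(ω) = ∫_Π x₂ ω dx`. -/
def impulse (ω : ℝ × ℝ → ℝ) : ℝ := ∫ x in UHP, x.2 * ω x

/-- `L¹(Π)` norm. -/
def normL1 (f : ℝ × ℝ → ℝ) : ℝ := ∫ x in UHP, |f x|

/-- `L²(Π)` norm. -/
def normL2 (f : ℝ × ℝ → ℝ) : ℝ := (∫ x in UHP, (f x) ^ 2) ^ ((1 : ℝ) / 2)

/-- `L^s(Π)` norm. -/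
def normLs (s : ℝ) (f : ℝ × ℝ → ℝ) : ℝ := (∫ x in UHP, |f x| ^ s) ^ (1 / s)

/-- Nonnegative member of `L¹(Π) ∩ L²(Π)`. -/
def NonnegL1L2 (ω : ℝ × ℝ → ℝ) : Prop :=
  (∀ x ∈ UHP, 0 ≤ ω x) ∧ IntegrableOn ω UHP ∧ IntegrableOn (fun x => (ω x) ^ 2) UHP

/-- Steiner symmetry in the `x₁` variable. -/
def SteinerSym (f : ℝ × ℝ → ℝ) : Prop :=
  (∀ x : ℝ × ℝ, f (-x.1, x.2) = f x) ∧
  ∀ x₂ : ℝ, 0 < x₂ → AntitoneOn (fun x₁ => f (x₁, x₂)) (Set.Ioi (0 : ℝ))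

/-- The admissible class `𝒜_{μ,ν}`. -/
def InAdm (μ ν : ℝ) (ω : ℝ × ℝ → ℝ) : Prop :=
  (∀ x ∈ UHP, 0 ≤ ω x) ∧ IntegrableOn ω UHP ∧ IntegrableOn (fun x => (ω x) ^ 2) UHP ∧
  IntegrableOn (fun x => x.2 * ω x) UHP ∧
  impulse ω = μ ∧ (∫ x in UHP, ω x) ≤ ν

/-- The energy functional `ℰ_λ(ω) = E(ω) − (1/(2λ)) ∫_Π ω²`. -/
def Efun (lam : ℝ) (ω : ℝ × ℝ → ℝ) : ℝ :=
  kineticE ω - (1 / (2 * lam)) * ∫ x in UHP, (ω x) ^ 2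

/-- The supremum `S_{μ,ν,λ} = sup_{ω ∈ 𝒜_{μ,ν}} ℰ_λ(ω)`. -/
def Sval (lam μ ν : ℝ) : ℝ := sSup {s | ∃ ω, InAdm μ ν ω ∧ s = Efun lam ω}

/-- `ω` is a maximizer, i.e. `ω ∈ Σ_{μ,ν,λ}`. -/
def IsMaximizer (lam μ ν : ℝ) (ω : ℝ × ℝ → ℝ) : Prop :=
  InAdm μ ν ω ∧ Efun lam ω = Sval lam μ ν

/-- Bessel function of the first kind of order one. -/
def J1 (r : ℝ) : ℝ :=
  ∑' k : ℕ, ((-1 : ℝ) ^ k / ((Nat.factorial k : ℝ) * (Nat.factorial (k + 1) : ℝ))) *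
    (r / 2) ^ (2 * k + 1)

/-- Modified Bessel function of the second kind of order one. -/
def K1 (r : ℝ) : ℝ := ∫ t in Set.Ioi (0 : ℝ), Real.exp (-(r * Real.cosh t)) * Real.cosh t

/-- The set of `t > 0` with `J₁(√(λ−1) t) ≠ 0` solving the transcendental equation
`t (K₁'(t)/K₁(t) + (λ−1)^{-1/2} J₁'(√(λ−1)t)/J₁(√(λ−1)t)) = λ/(λ−1)`. -/
def aSet (lam : ℝ) : Set ℝ :=
  {t | 0 < t ∧ J1 (Real.sqrt (lam - 1) * t) ≠ 0 ∧
    t * (deriv K1 t / K1 t +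
      (1 / Real.sqrt (lam - 1)) *
        (deriv J1 (Real.sqrt (lam - 1) * t) / J1 (Real.sqrt (lam - 1) * t))) = lam / (lam - 1)}

/-- The smallest positive solution `a = a(λ)`. -/
def aLam (lam : ℝ) : ℝ := sInf (aSet lam)

/-- The stream function `Ψ_L^{λ,W}` of the Lamb dipole, written in polar coordinates
`x₁ = r cos θ`, `x₂ = r sin θ` (so that `sin θ = x₂ / r`). -/
def PsiL (lam W : ℝ) (x : ℝ × ℝ) : ℝ :=
  if rad x ≤ aLam lam then
    ((-(W * aLam lam / (lam - 1)) / J1 (Real.sqrt (lam - 1) * aLam lam)) *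
        J1 (Real.sqrt (lam - 1) * rad x) + (W * lam / (lam - 1)) * rad x) * (x.2 / rad x)
  else (W * aLam lam / K1 (aLam lam)) * K1 (rad x) * (x.2 / rad x)

/-- The Lamb dipole `ω_L^{λ,W} = λ (Ψ_L^{λ,W} − W x₂)₊` restricted to `Π`. -/
def omegaL (lam W : ℝ) (x : ℝ × ℝ) : ℝ :=
  if 0 < x.2 then lam * max (PsiL lam W x - W * x.2) 0 else 0

/-- `ϱ(λ) = (∫_Π ω_L^{λ,1} dx) / I(ω_L^{λ,1})`. -/
def varrho (lam : ℝ) : ℝ := (∫ x in UHP, omegaL lam 1 x) / impulse (omegaL lam 1)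

/-- The Laplacian on `ℝ²`, written coordinatewise. -/
def lap (ψ : ℝ × ℝ → ℝ) (x : ℝ × ℝ) : ℝ :=
  deriv (deriv fun t => ψ (t, x.2)) x.1 + deriv (deriv fun t => ψ (x.1, t)) x.2

/-- Distance (in `L¹ ∩ L²` plus weighted `L¹`) from `ζ` to a set of functions `S`. -/
def distToSet (S : Set ((ℝ × ℝ) → ℝ)) (ζ : (ℝ × ℝ) → ℝ) : ℝ :=
  sInf {d | ∃ ω ∈ S, d = normL1 (fun x => ζ x - ω x) + normL2 (fun x => ζ x - ω x) +
    normL1 (fun x => x.2 * (ζ x - ω x))}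

end

section helpers
open Set

/-- quantile map -/
lemma quantile (B : Set ℝ) (hB : MeasurableSet B) (b : ℝ) (hb : volume B = ENNReal.ofReal b) (hb0 : 0 ≤ b) :
    ∃ Y : ℝ → ℝ, AEMeasurable Y (volume.restrict (Ioo 0 b)) ∧
      (volume.restrict (Ioo 0 b)).map Y = volume.restrict B ∧
      ∀ v ∈ Ioo 0 b, ∀ v' ∈ Ioo 0 b, v ≤ v' → v' - v ≤ Y v' - Y v := by
  have hfin : ∀ S : Set ℝ, volume (B ∩ S) ≠ ⊤ := fun S =>
    ne_top_of_le_ne_top (by rw [hb]; exact ENNReal.ofReal_ne_top) (measure_mono inter_subset_left)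
  set Ψ : ℝ → ℝ := fun t => volume.real (B ∩ Iic t) with hΨ
  have hmono : Monotone Ψ := fun s t hst =>
    measureReal_mono (inter_subset_inter_right _ (Iic_subset_Iic.2 hst)) (hfin _)
  have hlip : ∀ s t, s ≤ t → Ψ t ≤ Ψ s + (t - s) := by
    intro s t hst
    have h1 : B ∩ Iic t ⊆ (B ∩ Iic s) ∪ Ioc s t := by
      rintro x ⟨hx, hxt⟩
      by_cases h : x ≤ s
      · exact Or.inl ⟨hx, h⟩
      · exact Or.inr ⟨not_le.1 h, hxt⟩
    calc Ψ t ≤ volume.real ((B ∩ Iic s) ∪ Ioc s t) :=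
          measureReal_mono h1 (measure_union_ne_top (hfin _) (by simp))
      _ ≤ Ψ s + volume.real (Ioc s t) := measureReal_union_le _ _
      _ = Ψ s + (t - s) := by rw [Real.volume_real_Ioc_of_le hst]
  have hcont : Continuous Ψ := by
    refine (LipschitzWith.of_dist_le_mul (K := 1) ?_).continuous
    intro s t
    rw [Real.dist_eq, Real.dist_eq, NNReal.coe_one, one_mul]
    rcases le_total s t with h | h
    · rw [abs_sub_comm, abs_sub_comm s t, abs_of_nonneg (sub_nonneg.2 (hmono h)), abs_of_nonneg (sub_nonneg.2 h)]
      linarith [hlip s t h]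
    · rw [abs_of_nonneg (sub_nonneg.2 (hmono h)), abs_of_nonneg (sub_nonneg.2 h)]
      linarith [hlip t s h]
  have hle : ∀ t, Ψ t ≤ b := by
    intro t
    have : volume.real (B ∩ Iic t) ≤ volume.real B :=
      measureReal_mono inter_subset_left (by rw [hb]; exact ENNReal.ofReal_ne_top)
    rwa [measureReal_def volume B, hb, ENNReal.toReal_ofReal hb0] at this
  have htop : Tendsto Ψ atTop (nhds b) := by
    have h1 : Tendsto (fun t => volume (B ∩ Iic t)) atTop (nhds (volume (⋃ t, B ∩ Iic t))) :=
      tendsto_measure_iUnion_atTop (fun s t hst => inter_subset_inter_right _ (Iic_subset_Iic.2 hst))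
    rw [← inter_iUnion, iUnion_Iic, inter_univ, hb] at h1
    have := (ENNReal.tendsto_toReal ENNReal.ofReal_ne_top).comp h1
    rwa [ENNReal.toReal_ofReal hb0] at this
  have hbot : Tendsto Ψ atBot (nhds 0) := by
    have h1 : Tendsto (fun t => volume (B ∩ Iic t)) atBot (nhds (volume (⋂ t, B ∩ Iic t))) :=
      tendsto_measure_iInter_atBot (fun t => (hB.inter measurableSet_Iic).nullMeasurableSet)
        (fun s t hst => inter_subset_inter_right _ (Iic_subset_Iic.2 hst)) ⟨0, hfin _⟩
    have he : (⋂ t, B ∩ Iic t : Set ℝ) = ∅ := by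
      ext x
      simp only [mem_iInter, mem_inter_iff, mem_Iic, mem_empty_iff_false, iff_false, not_forall]
      exact ⟨x - 1, fun h => by linarith [h.2]⟩
    rw [he, measure_empty] at h1
    have := (ENNReal.tendsto_toReal ENNReal.zero_ne_top).comp h1
    rw [ENNReal.toReal_zero] at this
    exact this
  set Y : ℝ → ℝ := fun v => sInf {t | v ≤ Ψ t} with hY
  have hbdd : ∀ v ∈ Ioo 0 b, BddBelow {t | v ≤ Ψ t} := by
    intro v hv
    obtain ⟨t0, ht0⟩ := ((hbot.eventually (gt_mem_nhds hv.1))).exists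
    refine ⟨t0, fun t ht => ?_⟩
    by_contra h
    have := hmono (not_le.1 h).le
    simp only [mem_ofPred_eq] at ht
    linarith
  have hne : ∀ v ∈ Ioo 0 b, {t | v ≤ Ψ t}.Nonempty := by
    intro v hv
    obtain ⟨t0, ht0⟩ := ((htop.eventually (lt_mem_nhds hv.2))).exists
    exact ⟨t0, ht0.le⟩
  have hmem : ∀ v ∈ Ioo 0 b, v ≤ Ψ (Y v) := by
    intro v hv
    exact (isClosed_le continuous_const hcont).csInf_mem (hne v hv) (hbdd v hv)
  have hgal : ∀ v ∈ Ioo 0 b, ∀ t, Y v ≤ t ↔ v ≤ Ψ t := by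
    intro v hv t
    exact ⟨fun h => (hmem v hv).trans (hmono h), fun h => csInf_le (hbdd v hv) h⟩
  have hYm : MonotoneOn Y (Ioo 0 b) := by
    intro v hv v' hv' h
    rw [hgal v hv]; exact h.trans (hmem v' hv')
  have hae : AEMeasurable Y (volume.restrict (Ioo 0 b)) :=
    aemeasurable_restrict_of_monotoneOn measurableSet_Ioo hYm
  refine ⟨Y, hae, ?_, ?_⟩
  · have : IsFiniteMeasure (volume.restrict B) := ⟨by rw [Measure.restrict_apply_univ, hb]; exact ENNReal.ofReal_lt_top⟩
    refine Measure.ext_of_Iic _ _ (fun t => ?_)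
    rw [Measure.map_apply_of_aemeasurable hae measurableSet_Iic,
      Measure.restrict_apply' measurableSet_Ioo, Measure.restrict_apply measurableSet_Iic]
    have h2 : Y ⁻¹' Iic t ∩ Ioo 0 b = {v | v ≤ Ψ t} ∩ Ioo 0 b := by
      ext v
      simp only [mem_inter_iff, mem_preimage, mem_Iic, mem_ofPred_eq]
      exact and_congr_left (fun hv => hgal v hv t)
    have h3 : volume ({v | v ≤ Ψ t} ∩ Ioo 0 b) = ENNReal.ofReal (Ψ t) := by
      apply le_antisymm
      · calc _ ≤ volume (Ioc 0 (Ψ t)) := measure_mono (fun v hv => ⟨hv.2.1, hv.1⟩)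
          _ = _ := by rw [Real.volume_Ioc, sub_zero]
      · calc _ = volume (Ioo 0 (Ψ t)) := by rw [Real.volume_Ioo, sub_zero]
          _ ≤ volume ({v | v ≤ Ψ t} ∩ Ioo 0 b) := measure_mono (fun v hv => ⟨hv.2.le, hv.1, hv.2.trans_le (hle t)⟩)
    rw [h2, h3, inter_comm, hΨ]
    exact ENNReal.ofReal_toReal (hfin _)
  · intro v hv v' hv' h
    have h1 : Ψ (Y v) ≤ v := by
      refine le_of_tendsto (f := Ψ) (x := nhdsWithin (Y v) (Iio (Y v))) (hcont.continuousAt.tendsto.mono_left nhdsWithin_le_nhds) ?_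
      filter_upwards [self_mem_nhdsWithin] with t ht
      by_contra hc
      exact absurd ((hgal v hv t).2 (not_le.1 hc).le) (not_le.2 ht)
    have h2 := hmem v' hv'
    have h3 := hlip (Y v) (Y v') (hYm hv hv' h)
    linarith

lemma riesz_upper (A B : Set ℝ) (hA : MeasurableSet A) (hB : MeasurableSet B) (a b r l : ℝ)
    (ha : volume A = ENNReal.ofReal a) (ha0 : 0 ≤ a)
    (hb : volume B = ENNReal.ofReal b) (hb0 : 0 ≤ b) (hl : 0 ≤ l) (hlb : l ≤ b) :
    (∫⁻ y in B, volume (A ∩ Ioo (y - r) (y + r))) ≤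
      ENNReal.ofReal (a * b - l * (a - max 0 (2 * r - (b - l)))) := by
  obtain ⟨Y, hYm, hmap, hYl⟩ := quantile B hB b hb hb0
  have hPanti : Antitone (fun y : ℝ => volume (A ∩ Ici (y + r))) := fun y y' h =>
    measure_mono (inter_subset_inter_right _ (Ici_subset_Ici.2 (by linarith)))
  have hQmono : Monotone (fun y : ℝ => volume (A ∩ Iic (y - r))) := fun y y' h =>
    measure_mono (inter_subset_inter_right _ (Iic_subset_Iic.2 (by linarith)))
  set P := (fun y : ℝ => volume (A ∩ Ici (y + r)))
  set Q := (fun y : ℝ => volume (A ∩ Iic (y - r)))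
  have hPm : Measurable P := hPanti.measurable
  have hQm : Measurable Q := hQmono.measurable
  set N := (fun y : ℝ => volume (A ∩ Ioo (y - r) (y + r)))
  -- P + Q + N ≤ a when r > 0
  rcases le_or_gt r 0 with hr | hr
  · have : ∀ y, N y = 0 := fun y => by
      simp only [N]; rw [Ioo_eq_empty (by linarith), inter_empty, measure_empty]
    have h0 : N = fun _ => 0 := funext this
    rw [h0]; simp
  have hsum : ∀ y, N y + (P y + Q y) ≤ ENNReal.ofReal a := by
    intro y
    have e1 : P y + Q y = volume (A ∩ Ici (y + r) ∪ A ∩ Iic (y - r)) := by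
      rw [measure_union _ (hA.inter measurableSet_Iic)]
      rw [Set.disjoint_left]; rintro x ⟨_, h1⟩ ⟨_, h2⟩
      simp only [mem_Ici, mem_Iic] at h1 h2; linarith
    have e2 : N y + (P y + Q y) = volume (A ∩ Ioo (y - r) (y + r) ∪ (A ∩ Ici (y + r) ∪ A ∩ Iic (y - r))) := by
      rw [e1, measure_union _ ((hA.inter measurableSet_Ici).union (hA.inter measurableSet_Iic))]
      rw [Set.disjoint_left]; rintro x ⟨_, h1⟩ (⟨_, h2⟩ | ⟨_, h2⟩)
      · simp only [mem_Ici, mem_Iic, mem_Ioo] at h1 h2; linarith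
      · simp only [mem_Ici, mem_Iic, mem_Ioo] at h1 h2; linarith
    rw [e2, ← ha]
    exact measure_mono (by rintro x (h | h | h) <;> exact h.1)
  have hPQ : ENNReal.ofReal (l * (a - max 0 (2 * r - (b - l)))) ≤ ∫⁻ y in B, (P y + Q y) := by
    rw [lintegral_add_left hPm, ← hmap, lintegral_map' hPm.aemeasurable hYm,
      lintegral_map' hQm.aemeasurable hYm]
    have h1 : ∫⁻ v in Ioo 0 l, P (Y v) ≤ ∫⁻ v in Ioo 0 b, P (Y v) :=
      lintegral_mono_set (Ioo_subset_Ioo_right hlb)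
    have h2 : ∫⁻ v in Ioo 0 l, Q (Y (v + (b - l))) ≤ ∫⁻ v in Ioo 0 b, Q (Y v) := by
      have : ∫⁻ v in Ioo 0 l, Q (Y (v + (b - l))) = ∫⁻ v in Ioo (b - l) b, Q (Y v) := by
        rw [← (measurePreserving_add_right volume (b - l)).setLIntegral_comp_preimage_emb
          (MeasurableEquiv.addRight (b - l)).measurableEmbedding (fun v => Q (Y v))]
        congr 2
        ext v; simp
      rw [this]
      exact lintegral_mono_set (Ioo_subset_Ioo_left (by linarith))
    refine le_trans ?_ (add_le_add h1 h2)
    rw [← lintegral_add_left' (show AEMeasurable (fun v => P (Y v)) _ from hPm.comp_aemeasurable (hYm.mono_set (Ioo_subset_Ioo_right hlb)))]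
    have h3 : ∀ v ∈ Ioo 0 l, ENNReal.ofReal (a - max 0 (2 * r - (b - l))) ≤ P (Y v) + Q (Y (v + (b - l))) := by
      intro v hv
      have h4 := hYl v ⟨hv.1, hv.2.trans_le hlb⟩ (v + (b - l)) ⟨by linarith [hv.1], by linarith [hv.2]⟩ (by linarith)
      rw [ENNReal.ofReal_sub _ (le_max_left _ _), tsub_le_iff_right, ← ha]
      have h5 : A ⊆ (A ∩ Ici (Y v + r) ∪ A ∩ Iic (Y (v + (b - l)) - r)) ∪ Ioo (Y (v + (b - l)) - r) (Y v + r) := by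
        intro x hx
        by_cases c1 : Y v + r ≤ x
        · exact Or.inl (Or.inl ⟨hx, c1⟩)
        by_cases c2 : x ≤ Y (v + (b - l)) - r
        · exact Or.inl (Or.inr ⟨hx, c2⟩)
        · exact Or.inr ⟨not_le.1 c2, not_le.1 c1⟩
      refine (measure_mono h5).trans ((measure_union_le _ _).trans (add_le_add (measure_union_le _ _) ?_))
      rw [Real.volume_Ioo]
      apply ENNReal.ofReal_le_ofReal
      exact le_trans (by linarith) (le_max_right _ _)
    calc _ = ∫⁻ v in Ioo 0 l, ENNReal.ofReal (a - max 0 (2 * r - (b - l))) := by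
          rw [setLIntegral_const, Real.volume_Ioo, sub_zero, ENNReal.ofReal_mul hl, mul_comm]
      _ ≤ _ := setLIntegral_mono' measurableSet_Ioo h3
  have hNPQ : (∫⁻ y in B, N y) + ∫⁻ y in B, (P y + Q y) ≤ ENNReal.ofReal (a * b) := by
    rw [← lintegral_add_right N (show Measurable (fun y => P y + Q y) from hPm.add hQm)]
    calc _ ≤ ∫⁻ y in B, ENNReal.ofReal a := lintegral_mono hsum
      _ = _ := by rw [setLIntegral_const, hb, ENNReal.ofReal_mul ha0]
  rcases le_or_gt 0 (l * (a - max 0 (2 * r - (b - l)))) with hk | hk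
  · rw [ENNReal.ofReal_sub _ hk]
    apply ENNReal.le_sub_of_add_le_right ENNReal.ofReal_ne_top
    exact le_trans (by gcongr) hNPQ
  · refine le_trans le_self_add (hNPQ.trans (ENNReal.ofReal_le_ofReal (by linarith)))

lemma ofReal_integral_le_lint {α : Type*} [MeasurableSpace α] {μ : Measure α} (f : α → ℝ) :
    ENNReal.ofReal (∫ x, f x ∂μ) ≤ ∫⁻ x, ENNReal.ofReal (f x) ∂μ := by
  by_cases hf : Integrable f μ
  · rw [integral_eq_lintegral_pos_part_sub_lintegral_neg_part hf]
    refine le_trans (ENNReal.ofReal_le_ofReal (sub_le_self _ ENNReal.toReal_nonneg)) ENNReal.ofReal_toReal_le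
  · rw [integral_undef hf]; simp

lemma ramp_integral (b l l0 : ℝ) 
    (hc : (l0 ≤ 0 ∧ l = 0) ∨ (0 ≤ l0 ∧ l0 ≤ b ∧ l = l0) ∨ (b ≤ l0 ∧ l = b)) (hb0 : 0 ≤ b) :
    ∫ y in (-b/2)..(b/2), max 0 (l0 - b / 2 - y) = l0 * l - l ^ 2 / 2 := by
  have hl : 0 ≤ l ∧ l ≤ b := by rcases hc with h | h | h <;> constructor <;> linarith
  have hi : ∀ u v : ℝ, IntervalIntegrable (fun y => max 0 (l0 - b / 2 - y)) volume u v := fun u v =>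
    (by fun_prop : Continuous (fun y => max 0 (l0 - b / 2 - y))).intervalIntegrable _ _
  rw [← intervalIntegral.integral_add_adjacent_intervals (hi (-b/2) (-b/2+l)) (hi (-b/2+l) (b/2))]
  have h1 : ∫ y in (-b/2)..(-b/2+l), max 0 (l0 - b / 2 - y) = ∫ y in (-b/2)..(-b/2+l), (l0 - b / 2 - y) := by
    rcases hc with h | h
    · rw [h.2]; simp
    apply intervalIntegral.integral_congr
    intro y hy
    rw [uIcc_of_le (by linarith)] at hy
    rcases h with h | h <;> exact max_eq_right (by linarith [hy.1, hy.2])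
  have h2 : ∫ y in (-b/2+l)..(b/2), max 0 (l0 - b / 2 - y) = ∫ y in (-b/2+l)..(b/2), (0:ℝ) := by
    rcases hc with h | h | h
    rotate_left 2
    · rw [h.2, show -b/2 + b = b/2 by ring]; simp
    all_goals
      apply intervalIntegral.integral_congr
      intro y hy
      rw [uIcc_of_le (by linarith)] at hy
      exact max_eq_left (by linarith [hy.1, hy.2])
  rw [h1, h2, intervalIntegral.integral_sub (by simp) (by simp)]
  simp
  ring

lemma riesz_lower (a b r l l0 : ℝ) (ha0 : 0 ≤ a) (hb0 : 0 ≤ b)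
    (hl0 : l0 = (a + b - 2 * r) / 2) (hr : 0 ≤ r)
    (hc : (l0 ≤ 0 ∧ l = 0) ∨ (0 ≤ l0 ∧ l0 ≤ b ∧ l = l0) ∨ (b ≤ l0 ∧ l = b)) :
    ENNReal.ofReal (a * b - (2 * l0 * l - l ^ 2)) ≤ 
    (∫⁻ y in Ioo (-b/2) (b/2), volume (Ioo (-a/2) (a/2) ∩ Ioo (y - r) (y + r))) := by
  set φ : ℝ → ℝ := fun y => a - max 0 (l0 - b / 2 - y) - max 0 (l0 - b / 2 - (-y)) with hφ
  have hφc : Continuous φ := by fun_prop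
  have h1 : ∫ y in (-b/2)..(b/2), φ y = a * b - (2 * l0 * l - l ^ 2) := by
    simp only [hφ]
    have e := ramp_integral b l l0 hc hb0
    have e2 : ∫ y in (-b/2)..(b/2), max 0 (l0 - b / 2 - (-y)) = l0 * l - l ^ 2 / 2 := by
      rw [intervalIntegral.integral_comp_neg (fun y => max 0 (l0 - b / 2 - y)), ← e]
      congr 1 <;> ring
    rw [intervalIntegral.integral_sub, intervalIntegral.integral_sub, e, e2]
    · simp; ring
    all_goals apply Continuous.intervalIntegrable; fun_prop
  rw [← h1, intervalIntegral.integral_of_le (by linarith), integral_Ioc_eq_integral_Ioo]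
  refine (ofReal_integral_le_lint _).trans ?_
  refine setLIntegral_mono' measurableSet_Ioo (fun y hy => ?_)
  rw [Ioo_inter_Ioo, Real.volume_Ioo]
  apply ENNReal.ofReal_le_ofReal
  simp only [hφ, hl0]
  rcases hc with h | h | h <;>
  rcases max_cases 0 ((a + b - 2 * r) / 2 - b / 2 - y) with h1 | h1 <;>
  rcases max_cases 0 ((a + b - 2 * r) / 2 - b / 2 - (-y)) with h2 | h2 <;>
  rcases max_cases (-a/2) (y-r) with h3 | h3 <;>
  rcases min_cases (a/2) (y+r) with h4 | h4 <;> simp only [max_def, min_def] at * <;> linarith [hy.1, hy.2]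

lemma riesz_ioo_aux (A B : Set ℝ) (hA : MeasurableSet A) (hB : MeasurableSet B) (a b r : ℝ)
    (ha : volume A = ENNReal.ofReal a) (ha0 : 0 ≤ a) (hr : 0 ≤ r)
    (hb : volume B = ENNReal.ofReal b) (hb0 : 0 ≤ b) (hab : b ≤ a) :
    (∫⁻ y in B, volume (A ∩ Ioo (y - r) (y + r))) ≤
    (∫⁻ y in Ioo (-b/2) (b/2), volume (Ioo (-a/2) (a/2) ∩ Ioo (y - r) (y + r))) := by
  set l0 := (a + b - 2 * r) / 2 with hl0
  have key : ∀ l, 0 ≤ l → l ≤ b → ((l0 ≤ 0 ∧ l = 0) ∨ (0 ≤ l0 ∧ l0 ≤ b ∧ l = l0) ∨ (b ≤ l0 ∧ l = b)) →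
      l * (a - max 0 (2 * r - (b - l))) = 2 * l0 * l - l ^ 2 → 
    (∫⁻ y in B, volume (A ∩ Ioo (y - r) (y + r))) ≤
    (∫⁻ y in Ioo (-b/2) (b/2), volume (Ioo (-a/2) (a/2) ∩ Ioo (y - r) (y + r))) := by
    intro l h1 h2 hc h3
    refine (riesz_upper A B hA hB a b r l ha ha0 hb hb0 h1 h2).trans ?_
    rw [h3]
    exact riesz_lower a b r l l0 ha0 hb0 hl0 hr hc
  rcases le_or_gt l0 0 with h | h
  · exact key 0 le_rfl hb0 (Or.inl ⟨h, rfl⟩) (by simp)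
  rcases le_or_gt l0 b with h' | h'
  · refine key l0 h.le h' (Or.inr (Or.inl ⟨h.le, h', rfl⟩)) ?_
    rw [max_eq_right (by linarith)]
    rw [hl0]; ring
  · refine key b hb0 le_rfl (Or.inr (Or.inr ⟨h'.le, rfl⟩)) ?_
    rw [max_eq_right (by linarith)]
    rw [hl0]; ring

lemma riesz_swap (A B : Set ℝ) (hA : MeasurableSet A) (hB : MeasurableSet B) (r : ℝ) :
    (∫⁻ y in B, volume (A ∩ Ioo (y - r) (y + r))) = ∫⁻ x in A, volume (B ∩ Ioo (x - r) (x + r)) := by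
  have hS : MeasurableSet {z : ℝ × ℝ | z.1 ∈ A ∧ z.2 ∈ B ∧ |z.1 - z.2| < r} := by
    refine (measurable_fst hA).inter ((measurable_snd hB).inter ?_)
    exact measurableSet_lt (f := fun z : ℝ × ℝ => |z.1 - z.2|) (g := fun _ => r) (by fun_prop) (by fun_prop)
  have h1 := Measure.prod_apply (μ := (volume : Measure ℝ)) (ν := (volume : Measure ℝ)) hS
  have h2 := Measure.prod_apply_symm (μ := (volume : Measure ℝ)) (ν := (volume : Measure ℝ)) hS
  rw [h1] at h2
  rw [← lintegral_indicator hB, ← lintegral_indicator hA]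
  refine Eq.trans ?_ (h2.symm.trans ?_)
  · refine lintegral_congr fun y => ?_
    by_cases hy : y ∈ B
    · rw [indicator_of_mem hy]
      congr 1
      ext x
      simp only [mem_inter_iff, mem_Ioo, mem_preimage, mem_ofPred_eq, hy, true_and, abs_lt]
      exact and_congr_right fun _ => ⟨fun h => ⟨by linarith, by linarith⟩, fun h => ⟨by linarith, by linarith⟩⟩
    · rw [indicator_of_notMem hy]
      symm
      convert measure_empty (μ := (volume : Measure ℝ))
      ext x
      simp [hy]
  · refine lintegral_congr fun y => ?_
    by_cases hy : y ∈ A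
    · rw [indicator_of_mem hy]
      congr 1
      ext x
      simp only [mem_inter_iff, mem_Ioo, mem_preimage, mem_ofPred_eq, hy, true_and, abs_lt]
      exact and_congr_right fun _ => ⟨fun h => ⟨by linarith, by linarith⟩, fun h => ⟨by linarith, by linarith⟩⟩
    · rw [indicator_of_notMem hy]
      convert measure_empty (μ := (volume : Measure ℝ))
      ext x
      simp [hy]

lemma riesz_ioo (A B : Set ℝ) (hA : MeasurableSet A) (hB : MeasurableSet B) (a b r : ℝ)
    (ha : volume A = ENNReal.ofReal a) (ha0 : 0 ≤ a) (hr : 0 ≤ r)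
    (hb : volume B = ENNReal.ofReal b) (hb0 : 0 ≤ b) :
    (∫⁻ y in B, volume (A ∩ Ioo (y - r) (y + r))) ≤
    (∫⁻ y in Ioo (-b/2) (b/2), volume (Ioo (-a/2) (a/2) ∩ Ioo (y - r) (y + r))) := by
  rcases le_total b a with h | h
  · exact riesz_ioo_aux A B hA hB a b r ha ha0 hr hb hb0 h
  · rw [riesz_swap A B hA hB, riesz_swap _ _ measurableSet_Ioo measurableSet_Ioo]
    exact riesz_ioo_aux B A hB hA b a r hb hb0 hr ha ha0 h

lemma riesz_sets (A B As Bs C : Set ℝ) (hA : MeasurableSet A) (hB : MeasurableSet B)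
    (hAs : MeasurableSet As) (hBs : MeasurableSet Bs)
    (hC : MeasurableSet C) (a b : ℝ)
    (ha : volume A = ENNReal.ofReal a) (ha0 : 0 ≤ a) 
    (hb : volume B = ENNReal.ofReal b) (hb0 : 0 ≤ b)
    (hAs' : As =ᵐ[volume] Ioo (-a/2) (a/2)) (hBs' : Bs =ᵐ[volume] Ioo (-b/2) (b/2))
    (hCs : ∀ d ∈ C, ∀ d', |d'| ≤ |d| → d' ∈ C) :
    volume {z : ℝ × ℝ | z.1 ∈ A ∧ z.2 ∈ B ∧ z.1 - z.2 ∈ C} ≤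
      volume {z : ℝ × ℝ | z.1 ∈ As ∧ z.2 ∈ Bs ∧ z.1 - z.2 ∈ C} := by
  have slice : ∀ A B : Set ℝ, MeasurableSet A → MeasurableSet B → 
      volume {z : ℝ × ℝ | z.1 ∈ A ∧ z.2 ∈ B ∧ z.1 - z.2 ∈ C} = 
        ∫⁻ y in B, volume (A ∩ {x | x - y ∈ C}) := by
    intro A B hA hB
    have hS : MeasurableSet {z : ℝ × ℝ | z.1 ∈ A ∧ z.2 ∈ B ∧ z.1 - z.2 ∈ C} :=
      (measurable_fst hA).inter ((measurable_snd hB).inter ((measurable_fst.sub measurable_snd) hC))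
    have h2 := Measure.prod_apply_symm (μ := (volume : Measure ℝ)) (ν := (volume : Measure ℝ)) hS
    rw [Measure.volume_eq_prod, h2, ← lintegral_indicator hB]
    refine lintegral_congr fun y => ?_
    by_cases hy : y ∈ B
    · rw [indicator_of_mem hy]
      congr 1
      ext x
      simp only [mem_inter_iff, mem_preimage, mem_ofPred_eq, hy, true_and]
    · rw [indicator_of_notMem hy]
      convert measure_empty (μ := (volume : Measure ℝ))
      ext x
      simp [hy]
  rw [slice A B hA hB, slice As Bs hAs hBs]
  have e1 : (∫⁻ y in Bs, volume (As ∩ {x | x - y ∈ C})) =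
      ∫⁻ y in Ioo (-b/2) (b/2), volume (Ioo (-a/2) (a/2) ∩ {x | x - y ∈ C}) := by
    rw [setLIntegral_congr hBs']
    refine lintegral_congr fun y => ?_
    exact measure_congr (hAs'.inter (ae_eq_refl _))
  rw [e1]
  by_cases hCb : BddAbove ((fun d => |d|) '' C)
  · rcases C.eq_empty_or_nonempty with hCe | hCn
    · subst hCe; simp
    set r := sSup ((fun d => |d|) '' C) with hr
    have hr0 : 0 ≤ r := by
      obtain ⟨d, hd⟩ := hCn
      exact (abs_nonneg d).trans (le_csSup hCb ⟨d, hd, rfl⟩)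
    have hin : ∀ d, |d| < r → d ∈ C := by
      intro d hd
      obtain ⟨_, ⟨d', hd', rfl⟩, h⟩ := exists_lt_of_lt_csSup (hCn.image _) hd
      exact hCs d' hd' d h.le
    have hout : ∀ d ∈ C, |d| ≤ r := fun d hd => le_csSup hCb ⟨d, hd, rfl⟩
    have h1 : ∀ (A : Set ℝ) y, volume (A ∩ {x | x - y ∈ C}) = volume (A ∩ Ioo (y - r) (y + r)) := by
      intro A y
      apply le_antisymm
      · calc _ ≤ volume (A ∩ Icc (y - r) (y + r)) := by
              refine measure_mono (inter_subset_inter_right _ fun x hx => ?_)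
              have := abs_le.1 (hout _ hx)
              exact ⟨by linarith, by linarith⟩
          _ = _ := measure_congr ((ae_eq_refl _).inter Ioo_ae_eq_Icc.symm)
      · refine measure_mono (inter_subset_inter_right _ fun x hx => ?_)
        refine hin _ (abs_lt.2 ⟨by linarith [hx.1], by linarith [hx.2]⟩)
    simp only [h1]
    exact riesz_ioo A B hA hB a b r ha ha0 hr0 hb hb0
  · have hu : ∀ d, d ∈ C := by
      intro d
      rw [not_bddAbove_iff] at hCb
      obtain ⟨_, ⟨d', hd', rfl⟩, h⟩ := hCb |d|
      exact hCs d' hd' d h.le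
    have h1 : ∀ (A : Set ℝ) y, (A ∩ {x | x - y ∈ C}) = A := by
      intro A y; ext x; simp [hu]
    simp only [h1]
    rw [setLIntegral_const, setLIntegral_const, ha, hb, Real.volume_Ioo, Real.volume_Ioo]
    apply le_of_eq
    congr 2 <;> ring

lemma layer {α : Type*} [MeasurableSpace α] (μ : Measure α) [SFinite μ] (u : α → ℝ) (hu : Measurable u)
    (φ : α → ENNReal) (hφ : Measurable φ) :
    ∫⁻ z, ENNReal.ofReal (u z) * φ z ∂μ = ∫⁻ s in Ioi (0 : ℝ), ∫⁻ z in {z | s < u z}, φ z ∂μ := by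
  have h1 : ∀ z, ENNReal.ofReal (u z) * φ z = ∫⁻ s in Ioi (0 : ℝ), {p : ℝ × α | p.1 < u p.2}.indicator (fun p => φ p.2) (s, z) := by
    intro z
    have : ∀ s : ℝ, {p : ℝ × α | p.1 < u p.2}.indicator (fun p => φ p.2) (s, z) = (Iio (u z)).indicator (fun _ => φ z) s := by
      intro s
      simp only [indicator, mem_ofPred_eq, mem_Iio]
    simp only [this]
    rw [lintegral_indicator measurableSet_Iio, lintegral_const, Measure.restrict_restrict measurableSet_Iio,
      Measure.restrict_apply_univ, inter_comm, Ioi_inter_Iio, Real.volume_Ioo, sub_zero, mul_comm]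
  simp only [h1]
  have hS : MeasurableSet {p : ℝ × α | p.1 < u p.2} := measurableSet_lt measurable_fst (hu.comp measurable_snd)
  rw [lintegral_lintegral_swap]
  · refine lintegral_congr fun s => ?_
    rw [← lintegral_indicator (measurableSet_lt measurable_const hu)]
    rfl
  · exact (((hφ.comp measurable_snd).indicator hS).comp measurable_swap).aemeasurable

lemma layer_mono {α : Type*} [MeasurableSpace α] (μ μ' : Measure α) [SFinite μ] [SFinite μ'] (u u' : α → ℝ) (hu : Measurable u)
    (hu' : Measurable u')
    (φ φ' : α → ENNReal) (hφ : Measurable φ) (hφ' : Measurable φ')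
    (h : ∀ s > 0, ∫⁻ z in {z | s < u z}, φ z ∂μ ≤ ∫⁻ z in {z | s < u' z}, φ' z ∂μ') :
    ∫⁻ z, ENNReal.ofReal (u z) * φ z ∂μ ≤ ∫⁻ z, ENNReal.ofReal (u' z) * φ' z ∂μ' := by
  rw [layer μ u hu φ hφ, layer μ' u' hu' φ' hφ']
  exact setLIntegral_mono' measurableSet_Ioi (fun s hs => h s hs)

def IsRearr (f fs : ℝ → ℝ) : Prop := ∀ s > 0, volume {x | s < f x} ≠ ⊤ ∧
  {x | s < fs x} =ᵐ[volume] Ioo (-(volume {x | s < f x}).toReal / 2) ((volume {x | s < f x}).toReal / 2)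

lemma riesz_fun (f k fs ks h : ℝ → ℝ) (hf : Measurable f) (hk : Measurable k) (hfs : Measurable fs)
    (hks : Measurable ks) (hh : Measurable h) (h1 : IsRearr f fs) (h2 : IsRearr k ks)
    (hanti : ∀ d d', |d'| ≤ |d| → h d ≤ h d') :
    ∫⁻ x, ∫⁻ y, ENNReal.ofReal (f x) * (ENNReal.ofReal (k y) * ENNReal.ofReal (h (x - y))) ≤
    ∫⁻ x, ∫⁻ y, ENNReal.ofReal (fs x) * (ENNReal.ofReal (ks y) * ENNReal.ofReal (h (x - y))) := by
  have e : ∀ f k : ℝ → ℝ, Measurable f → Measurable k →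
    ∫⁻ x, ∫⁻ y, ENNReal.ofReal (f x) * (ENNReal.ofReal (k y) * ENNReal.ofReal (h (x - y))) =
    ∫⁻ z : ℝ × ℝ, ENNReal.ofReal (f z.1) * (ENNReal.ofReal (k z.2) * (ENNReal.ofReal (h (z.1 - z.2)) * 1)) := by
    intro f k hf hk
    rw [Measure.volume_eq_prod, lintegral_prod _ (by fun_prop)]
    simp
  rw [e f k hf hk, e fs ks hfs hks]
  apply layer_mono _ _ _ _ (by fun_prop) (by fun_prop) _ _ (by fun_prop) (by fun_prop)
  intro s hs
  apply layer_mono _ _ _ _ (by fun_prop) (by fun_prop) _ _ (by fun_prop) (by fun_prop)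
  intro t ht
  apply layer_mono _ _ _ _ (by fun_prop) (by fun_prop) _ _ (by fun_prop) (by fun_prop)
  intro q hq
  have key := riesz_sets {x | s < f x} {x | t < k x} {x | s < fs x} {x | t < ks x} {x | q < h x}
    (measurableSet_lt (by fun_prop) (by fun_prop)) (measurableSet_lt (by fun_prop) (by fun_prop))
    (measurableSet_lt (by fun_prop) (by fun_prop)) (measurableSet_lt (by fun_prop) (by fun_prop))
    (measurableSet_lt (by fun_prop) (by fun_prop)) _ _ 
    (ENNReal.ofReal_toReal (h1 s hs).1).symm ENNReal.toReal_nonneg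
    (ENNReal.ofReal_toReal (h2 t ht).1).symm ENNReal.toReal_nonneg
    (h1 s hs).2 (h2 t ht).2 (fun d hd d' hd' => lt_of_lt_of_le hd (hanti d d' hd'))
  have e2 : ∀ f k : ℝ → ℝ, Measurable f → Measurable k →
      ∫⁻ z in {z : ℝ × ℝ | q < h (z.1 - z.2)}, 1 ∂(((volume : Measure (ℝ × ℝ)).restrict {z : ℝ × ℝ | s < f z.1}).restrict {z : ℝ × ℝ | t < k z.2})
      = volume {z : ℝ × ℝ | z.1 ∈ {x | s < f x} ∧ z.2 ∈ {x | t < k x} ∧ z.1 - z.2 ∈ {x | q < h x}} := by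
    intro f k hf hk
    have m1 : MeasurableSet {z : ℝ × ℝ | s < f z.1} := measurableSet_lt (by fun_prop) (by fun_prop)
    have m2 : MeasurableSet {z : ℝ × ℝ | t < k z.2} := measurableSet_lt (by fun_prop) (by fun_prop)
    have m3 : MeasurableSet {z : ℝ × ℝ | q < h (z.1 - z.2)} := measurableSet_lt (by fun_prop) (by fun_prop)
    rw [setLIntegral_one, Measure.restrict_apply m3, Measure.restrict_apply (m3.inter m2)]
    congr 1
    ext z
    simp only [mem_inter_iff, mem_ofPred_eq]
    tauto
  rw [e2 f k hf hk, e2 fs ks hfs hks]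
  exact key

/-- distribution function of the slices -/
noncomputable def distr (w : ℝ × ℝ → ℝ) (s x₂ : ℝ) : ENNReal := volume {x₁ : ℝ | s < w (x₁, x₂)}

/-- Steiner symmetrization -/
noncomputable def steiner (w : ℝ × ℝ → ℝ) (x : ℝ × ℝ) : ℝ :=
  (volume {s : ℝ | 0 < s ∧ ENNReal.ofReal (2 * |x.1|) < distr w s x.2}).toReal

lemma distr_measurable (w : ℝ × ℝ → ℝ) (hw : Measurable w) :
    Measurable (fun q : ℝ × ℝ => distr w q.1 q.2) := by
  have hS : MeasurableSet {p : (ℝ × ℝ) × ℝ | p.1.1 < w (p.2, p.1.2)} :=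
    measurableSet_lt (by fun_prop) (by fun_prop)
  exact measurable_measure_prodMk_left (ν := (volume : Measure ℝ)) hS

lemma steiner_measurable (w : ℝ × ℝ → ℝ) (hw : Measurable w) : Measurable (steiner w) := by
  have hd := distr_measurable w hw
  have hS : MeasurableSet {p : (ℝ × ℝ) × ℝ | 0 < p.2 ∧ ENNReal.ofReal (2 * |p.1.1|) < distr w p.2 p.1.2} := by
    refine MeasurableSet.inter (measurableSet_lt (f := fun _ : (ℝ × ℝ) × ℝ => (0 : ℝ)) (g := fun p : (ℝ × ℝ) × ℝ => p.2) (by fun_prop) (by fun_prop)) ?_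
    refine measurableSet_lt (f := fun p : (ℝ × ℝ) × ℝ => ENNReal.ofReal (2 * |p.1.1|)) 
      (g := fun p : (ℝ × ℝ) × ℝ => distr w p.2 p.1.2) (by fun_prop) ?_
    exact hd.comp (by fun_prop : Measurable (fun p : (ℝ × ℝ) × ℝ => (p.2, p.1.2)))
  exact (measurable_measure_prodMk_left (ν := (volume : Measure ℝ)) hS).ennreal_toReal

lemma distr_anti (w : ℝ × ℝ → ℝ) (x₂ : ℝ) : Antitone (fun s => distr w s x₂) := fun s t hst =>
  measure_mono (fun _ hx => lt_of_le_of_lt hst hx)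

lemma distr_markov (w : ℝ × ℝ → ℝ) (hw : Measurable w) (x₂ s : ℝ) (hs : 0 < s) :
    distr w s x₂ ≤ (∫⁻ x₁, ENNReal.ofReal (w (x₁, x₂))) / ENNReal.ofReal s := by
  refine le_trans (measure_mono ?_) (meas_ge_le_lintegral_div (by fun_prop) 
    (by simpa using hs) ENNReal.ofReal_ne_top)
  intro x hx
  exact ENNReal.ofReal_le_ofReal (le_of_lt hx)

lemma distr_lt_top (w : ℝ × ℝ → ℝ) (hw : Measurable w) (x₂ s : ℝ) (hs : 0 < s)
    (hfin : ∫⁻ x₁, ENNReal.ofReal (w (x₁, x₂)) ≠ ⊤) : distr w s x₂ ≠ ⊤ :=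
  ne_top_of_le_ne_top (ENNReal.div_ne_top hfin (by simpa using hs)) (distr_markov w hw x₂ s hs)

lemma lt_steiner_iff (w : ℝ × ℝ → ℝ) (hw : Measurable w) (x₁ x₂ s : ℝ) (hs : 0 ≤ s) (hx : x₁ ≠ 0)
    (hfin : ∫⁻ x₁, ENNReal.ofReal (w (x₁, x₂)) ≠ ⊤) :
    s < steiner w (x₁, x₂) ↔ ENNReal.ofReal (2 * |x₁|) < distr w s x₂ := by
  have hanti := distr_anti w x₂
  have hpos : 0 < 2 * |x₁| := by positivity
  set T : Set ℝ := {s : ℝ | 0 < s ∧ ENNReal.ofReal (2 * |x₁|) < distr w s x₂} with hT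
  set I := ∫⁻ x₁, ENNReal.ofReal (w (x₁, x₂)) with hI
  have hTfin : volume T ≠ ⊤ := by
    have : T ⊆ Ioc 0 (I.toReal / (2 * |x₁|)) := by
      rintro t ⟨ht, h⟩
      refine ⟨ht, ?_⟩
      have h2 := h.trans_le (distr_markov w hw x₂ t ht)
      rw [← hI, ← ENNReal.ofReal_toReal hfin, ← ENNReal.ofReal_div_of_pos ht] at h2
      have h3 := (ENNReal.ofReal_lt_ofReal_iff_of_nonneg hpos.le).1 h2
      rw [lt_div_iff₀ ht] at h3
      rw [le_div_iff₀ hpos]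
      linarith
    exact ne_top_of_le_ne_top (by simp) (measure_mono this)
  have hst : steiner w (x₁, x₂) = (volume T).toReal := rfl
  constructor
  · intro h
    by_contra hc
    have : T ⊆ Ioc 0 s := by
      rintro t ⟨ht, h2⟩
      refine ⟨ht, ?_⟩
      by_contra hts
      exact hc (h2.trans_le (hanti (not_le.1 hts).le))
    have h3 := ENNReal.toReal_mono (by simp) (measure_mono (μ := volume) this)
    rw [← hst, Real.volume_Ioc, sub_zero, ENNReal.toReal_ofReal hs] at h3
    linarith
  · intro h
    have hU : {x₁ : ℝ | s < w (x₁, x₂)} = ⋃ n : ℕ, {x₁ : ℝ | s + 1 / ((n : ℝ) + 1) < w (x₁, x₂)} := by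
      ext y
      simp only [mem_ofPred_eq, mem_iUnion]
      constructor
      · intro hy
        obtain ⟨n, hn⟩ := exists_nat_one_div_lt (sub_pos.2 hy)
        exact ⟨n, by linarith⟩
      · rintro ⟨n, hn⟩
        have : (0:ℝ) < 1 / ((n : ℝ) + 1) := by positivity
        linarith
    have hlim : Tendsto (fun n : ℕ => distr w (s + 1 / ((n : ℝ) + 1)) x₂) atTop (nhds (distr w s x₂)) := by
      have := tendsto_measure_iUnion_atTop (μ := (volume : Measure ℝ)) 
        (s := fun n : ℕ => {x₁ : ℝ | s + 1 / ((n : ℝ) + 1) < w (x₁, x₂)}) ?_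
      · rw [← hU] at this; exact this
      · intro n m hnm y hy
        have h5 : 1 / ((m : ℝ) + 1) ≤ 1 / ((n : ℝ) + 1) := Nat.one_div_le_one_div hnm
        have h6 : s + 1 / ((n : ℝ) + 1) < w (y, x₂) := hy
        exact show s + 1 / ((m : ℝ) + 1) < w (y, x₂) by linarith
    obtain ⟨n, hn⟩ := (hlim.eventually (lt_mem_nhds h)).exists
    have hp : (0:ℝ) < 1 / ((n : ℝ) + 1) := by positivity
    have hsub : Ioc 0 (s + 1 / ((n : ℝ) + 1)) ⊆ T := fun t ht => ⟨ht.1, hn.trans_le (hanti ht.2)⟩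
    have h3 := ENNReal.toReal_mono hTfin (measure_mono (μ := volume) hsub)
    rw [← hst, Real.volume_Ioc, sub_zero, ENNReal.toReal_ofReal (by linarith)] at h3
    linarith

lemma steiner_level (w : ℝ × ℝ → ℝ) (hw : Measurable w) (x₂ : ℝ)
    (hfin : ∫⁻ x₁, ENNReal.ofReal (w (x₁, x₂)) ≠ ⊤) : 
    IsRearr (fun x₁ => w (x₁, x₂)) (fun x₁ => steiner w (x₁, x₂)) := by
  intro s hs
  have ht := distr_lt_top w hw x₂ s hs hfin
  refine ⟨ht, ?_⟩
  have h0 : ∀ᵐ x : ℝ, x ≠ 0 := by simp [ae_iff]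
  filter_upwards [h0] with x hx
  apply propext
  have h1 := lt_steiner_iff w hw x x₂ s hs.le hx hfin
  rw [show ({x₁ | s < steiner w (x₁, x₂)} x : Prop) = (s < steiner w (x, x₂)) from rfl, h1]
  change _ ↔ x ∈ Ioo (-(distr w s x₂).toReal / 2) ((distr w s x₂).toReal / 2)
  rw [ENNReal.ofReal_lt_iff_lt_toReal (by positivity) ht]
  constructor
  · intro h
    have := abs_lt.1 (show |x| < (distr w s x₂).toReal / 2 by linarith)
    exact ⟨by linarith, by linarith⟩
  · rintro ⟨h2, h3⟩
    have := abs_lt.2 (show -((distr w s x₂).toReal / 2) < x ∧ x < (distr w s x₂).toReal / 2 from ⟨by linarith, by linarith⟩)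
    linarith

lemma steiner_lintegral_rpow (w : ℝ × ℝ → ℝ) (hw : Measurable w) (hw0 : ∀ x, 0 ≤ w x) (x₂ : ℝ)
    (hfin : ∫⁻ x₁, ENNReal.ofReal (w (x₁, x₂)) ≠ ⊤) (p : ℝ) (hp : 0 < p) :
    ∫⁻ x₁, ENNReal.ofReal (steiner w (x₁, x₂) ^ p) = ∫⁻ x₁, ENNReal.ofReal (w (x₁, x₂) ^ p) := by
  have hs := steiner_measurable w hw
  rw [lintegral_rpow_eq_lintegral_meas_lt_mul volume (f := fun x₁ => steiner w (x₁, x₂))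
      (ae_of_all _ fun x => ENNReal.toReal_nonneg) (by fun_prop) hp,
    lintegral_rpow_eq_lintegral_meas_lt_mul volume (ae_of_all _ fun x => hw0 _) (by fun_prop) hp]
  congr 1
  refine setLIntegral_congr_fun measurableSet_Ioi fun s hs' => ?_
  have h := steiner_level w hw x₂ hfin s hs'
  rw [measure_congr h.2, Real.volume_Ioo]
  congr 1
  rw [show (volume {x | s < w (x, x₂)}).toReal / 2 - -(volume {x | s < w (x, x₂)}).toReal / 2 = (volume {x | s < w (x, x₂)}).toReal by ring]
  exact ENNReal.ofReal_toReal h.1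

lemma steiner_nonneg (w : ℝ × ℝ → ℝ) (x : ℝ × ℝ) : 0 ≤ steiner w x := ENNReal.toReal_nonneg

lemma steiner_anti (w : ℝ × ℝ → ℝ) (hw : Measurable w) (x₂ : ℝ)
    (hfin : ∫⁻ x₁, ENNReal.ofReal (w (x₁, x₂)) ≠ ⊤) :
    AntitoneOn (fun x₁ => steiner w (x₁, x₂)) (Set.Ioi (0 : ℝ)) := by
  intro x hx y hy hxy
  refine le_of_forall_lt fun s hs => ?_
  rcases lt_or_ge s 0 with h | h
  · exact h.trans_le (steiner_nonneg _ _)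
  · dsimp only at hs ⊢
    rw [lt_steiner_iff w hw _ _ _ h (ne_of_gt hx) hfin]
    rw [lt_steiner_iff w hw _ _ _ h (ne_of_gt hy) hfin] at hs
    refine lt_of_le_of_lt (ENNReal.ofReal_le_ofReal ?_) hs
    rw [abs_of_pos hx, abs_of_pos hy]; linarith

lemma steiner_even (w : ℝ × ℝ → ℝ) (x : ℝ × ℝ) : steiner w (-x.1, x.2) = steiner w x := by
  simp only [steiner, abs_neg]

lemma steiner_zero (w : ℝ × ℝ → ℝ) (x₁ x₂ : ℝ) (h : ∀ x, w (x, x₂) = 0) : steiner w (x₁, x₂) = 0 := by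
  have : {s : ℝ | 0 < s ∧ ENNReal.ofReal (2 * |x₁|) < distr w s x₂} = ∅ := by
    ext s
    simp only [mem_ofPred_eq, mem_empty_iff_false, iff_false, not_and]
    intro hs
    have h0 : {x₁ : ℝ | s < w (x₁, x₂)} = ∅ := by
      ext x; simp [h, hs.le]
    simp [distr, h0]
  simp only [steiner]
  rw [this]; simp

lemma K0_int (r : ℝ) (hr : 0 < r) : IntegrableOn (fun t => Real.exp (-(r * Real.cosh t))) (Ioi 0) := by
  refine Integrable.mono' (exp_neg_integrableOn_Ioi 0 hr) (by fun_prop) ?_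
  refine (ae_restrict_iff' measurableSet_Ioi).2 (ae_of_all _ fun t ht => ?_)
  rw [Real.norm_eq_abs, abs_of_pos (Real.exp_pos _)]
  apply Real.exp_le_exp.2
  have h1 : t ≤ Real.sinh t := Real.self_le_sinh_iff.2 (le_of_lt ht)
  have h2 := Real.sinh_lt_cosh t
  nlinarith

lemma K0_meas : Measurable K0 := by
  have : StronglyMeasurable (fun p : ℝ × ℝ => Real.exp (-(p.1 * Real.cosh p.2))) := by
    apply Measurable.stronglyMeasurable; fun_prop
  exact (this.integral_prod_right (ν := volume.restrict (Ioi (0:ℝ)))).measurable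

lemma K0_nonneg (r : ℝ) : 0 ≤ K0 r := integral_nonneg fun t => (Real.exp_pos _).le

lemma convex_exp_sqrt (c : ℝ) (hc : 0 ≤ c) : ConvexOn ℝ (Ici 0) (fun s => Real.exp (-(c * √s))) := by
  refine ⟨convex_Ici 0, fun x hx y hy a b ha hb hab => ?_⟩
  have h1 := Real.strictConcaveOn_sqrt.concaveOn.2 hx hy ha hb hab
  have h2 := convexOn_exp.2 (mem_univ (-(c * √x))) (mem_univ (-(c * √y))) ha hb hab
  refine le_trans (Real.exp_le_exp.2 ?_) h2
  simp only [smul_eq_mul] at h1 ⊢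
  nlinarith [mul_le_mul_of_nonneg_left h1 hc]

lemma four_point (φ : ℝ → ℝ) (hφ : ConvexOn ℝ (Ici 0) φ) (s β δ : ℝ) (hs : 0 ≤ s) (hβ : 0 ≤ β) (hδ : 0 ≤ δ) :
    φ (s + δ) - φ (s + δ + β) ≤ φ s - φ (s + β) := by
  rcases eq_or_lt_of_le (add_nonneg hβ hδ) with h | h
  · have h1 : β = 0 := by linarith
    have h2 : δ = 0 := by linarith
    simp [h1, h2]
  have mp := @hφ.2
  have e1 := mp hs (show s + δ + β ∈ Ici (0:ℝ) by simp only [mem_Ici]; linarith) (a := β / (β + δ)) (b := δ / (β + δ))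
    (by positivity) (by positivity) (by field_simp)
  have e2 := mp hs (show s + δ + β ∈ Ici (0:ℝ) by simp only [mem_Ici]; linarith) (a := δ / (β + δ)) (b := β / (β + δ))
    (by positivity) (by positivity) (by field_simp; ring)
  simp only [smul_eq_mul] at e1 e2
  rw [show β / (β + δ) * s + δ / (β + δ) * (s + δ + β) = s + δ by field_simp; ring] at e1
  rw [show δ / (β + δ) * s + β / (β + δ) * (s + δ + β) = s + β by field_simp; ring] at e2
  have e3 : β / (β + δ) + δ / (β + δ) = 1 := by field_simp
  have e4 : (β / (β + δ) + δ / (β + δ)) * (φ s + φ (s + δ + β)) = φ s + φ (s + δ + β) := by rw [e3, one_mul]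
  linarith

lemma kern_anti (a b : ℝ) (ha : a ≠ 0) (hab : a ^ 2 ≤ b ^ 2) (d d' : ℝ) (h : |d'| ≤ |d|) :
    K0 (√(d ^ 2 + a ^ 2)) - K0 (√(d ^ 2 + b ^ 2)) ≤ K0 (√(d' ^ 2 + a ^ 2)) - K0 (√(d' ^ 2 + b ^ 2)) := by
  have hd : d' ^ 2 ≤ d ^ 2 := sq_le_sq.2 h
  have ha2 : 0 < a ^ 2 := by positivity
  have hb2 : 0 < b ^ 2 := by linarith
  have i1 := K0_int (√(d ^ 2 + a ^ 2)) (by positivity)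
  have i2 := K0_int (√(d ^ 2 + b ^ 2)) (by positivity)
  have i3 := K0_int (√(d' ^ 2 + a ^ 2)) (by positivity)
  have i4 := K0_int (√(d' ^ 2 + b ^ 2)) (by positivity)
  unfold K0
  rw [← integral_sub i1 i2, ← integral_sub i3 i4]
  refine integral_mono (i1.sub i2) (i3.sub i4) fun t => ?_
  have hc := four_point _ (convex_exp_sqrt (Real.cosh t) (Real.cosh_pos t).le) (d' ^ 2 + a ^ 2) (b ^ 2 - a ^ 2)
    (d ^ 2 - d' ^ 2) (by positivity) (by linarith) (by linarith)
  rw [show d' ^ 2 + a ^ 2 + (d ^ 2 - d' ^ 2) = d ^ 2 + a ^ 2 by ring,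
    show d ^ 2 + a ^ 2 + (b ^ 2 - a ^ 2) = d ^ 2 + b ^ 2 by ring,
    show d' ^ 2 + a ^ 2 + (b ^ 2 - a ^ 2) = d' ^ 2 + b ^ 2 by ring] at hc
  simp only [mul_comm (Real.cosh t)] at hc
  exact hc

lemma kern_nonneg (a b : ℝ) (ha : a ≠ 0) (hab : a ^ 2 ≤ b ^ 2) (d : ℝ) :
    0 ≤ K0 (√(d ^ 2 + a ^ 2)) - K0 (√(d ^ 2 + b ^ 2)) := by
  have ha2 : 0 < a ^ 2 := by positivity
  have hb2 : 0 < b ^ 2 := by linarith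
  have i1 := K0_int (√(d ^ 2 + a ^ 2)) (by positivity)
  have i2 := K0_int (√(d ^ 2 + b ^ 2)) (by positivity)
  unfold K0
  rw [sub_nonneg]
  refine integral_mono i2 i1 fun t => ?_
  apply Real.exp_le_exp.2
  have := Real.sqrt_le_sqrt (show d ^ 2 + a ^ 2 ≤ d ^ 2 + b ^ 2 by linarith)
  have := Real.cosh_pos t
  nlinarith

/-- kernel profile -/
noncomputable def prof (x₂ y₂ d : ℝ) : ℝ :=
  (1 / (2 * Real.pi)) * (K0 (√(d ^ 2 + (x₂ - y₂) ^ 2)) - K0 (√(d ^ 2 + (-x₂ - y₂) ^ 2)))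

lemma GUHP_eq (x y : ℝ × ℝ) : GUHP x y = prof x.2 y.2 (x.1 - y.1) := by
  simp only [GUHP, Gker, rad, reflPt, prof, Prod.fst_sub, Prod.snd_sub]
  ring

lemma prof_meas : Measurable (fun p : ℝ × ℝ × ℝ => prof p.1 p.2.1 p.2.2) := by
  have := K0_meas
  unfold prof
  fun_prop

lemma prof_meas' {α : Type*} [MeasurableSpace α] {f g h : α → ℝ} (hf : Measurable f) (hg : Measurable g)
    (hh : Measurable h) : Measurable (fun x => prof (f x) (g x) (h x)) := by
  have := K0_meas
  unfold prof
  fun_prop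

lemma prof_anti (x₂ y₂ : ℝ) (hx : 0 < x₂) (hy : 0 < y₂) (hxy : x₂ ≠ y₂) (d d' : ℝ) (h : |d'| ≤ |d|) :
    prof x₂ y₂ d ≤ prof x₂ y₂ d' := by
  unfold prof
  refine mul_le_mul_of_nonneg_left ?_ (by positivity)
  exact kern_anti _ _ (sub_ne_zero.2 hxy) (by nlinarith [mul_pos hx hy]) d d' h

lemma prof_nonneg (x₂ y₂ : ℝ) (hx : 0 < x₂) (hy : 0 < y₂) (hxy : x₂ ≠ y₂) (d : ℝ) :
    0 ≤ prof x₂ y₂ d := by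
  unfold prof
  refine mul_nonneg (by positivity) ?_
  exact kern_nonneg _ _ (sub_ne_zero.2 hxy) (by nlinarith [mul_pos hx hy]) d

/-- majorant kernel -/
noncomputable def kap (z : ℝ × ℝ) : ENNReal := ∫⁻ t in Ioi (0 : ℝ), ENNReal.ofReal (Real.exp (-(rad z * Real.cosh t)))

lemma kap_meas : Measurable kap := by
  unfold kap rad
  exact Measurable.lintegral_prod_right' (ν := volume.restrict (Ioi (0:ℝ)))
    (f := fun p : (ℝ × ℝ) × ℝ => ENNReal.ofReal (Real.exp (-(√(p.1.1 ^ 2 + p.1.2 ^ 2) * Real.cosh p.2)))) (by fun_prop)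

lemma GUHP_le (x y : ℝ × ℝ) : ENNReal.ofReal (GUHP x y) ≤ kap (x - y) := by
  refine le_trans (ENNReal.ofReal_le_ofReal ?_) (ofReal_integral_le_lint (μ := volume.restrict (Ioi (0:ℝ))) _)
  change _ ≤ K0 (rad (x - y))
  unfold GUHP Gker
  have h1 := K0_nonneg (rad (x - y))
  have h2 := K0_nonneg (rad (reflPt x - y))
  have h3 : 1 / (2 * Real.pi) ≤ 1 := by
    rw [div_le_one (by positivity)]; linarith [Real.pi_gt_three]
  have h4 : 0 ≤ 1 / (2 * Real.pi) := by positivity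
  nlinarith [mul_nonneg h4 h2]

lemma lint_exp_abs (k : ℝ) (hk : 0 < k) : ∫⁻ x : ℝ, ENNReal.ofReal (Real.exp (-(k * |x|))) = ENNReal.ofReal (2 / k) := by
  have hi : IntegrableOn (fun x : ℝ => Real.exp (-(k * x))) (Ioi 0) := by
    simpa using exp_neg_integrableOn_Ioi 0 hk
  have h1 : ∫⁻ x in Ioi (0:ℝ), ENNReal.ofReal (Real.exp (-(k * |x|))) = ENNReal.ofReal (1 / k) := by
    rw [setLIntegral_congr_fun (g := fun x => ENNReal.ofReal (Real.exp (-(k * x)))) measurableSet_Ioi 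
      (fun x hx => by dsimp only; rw [abs_of_pos hx])]
    rw [← ofReal_integral_eq_lintegral_ofReal hi (ae_of_all _ fun x => (Real.exp_pos _).le)]
    have := integral_exp_mul_Ioi (a := -k) (by linarith) 0
    congr 1
    simp only [neg_mul, mul_zero, neg_zero, Real.exp_zero] at this
    rw [this]; ring
  have h2 : ∫⁻ x in Iio (0:ℝ), ENNReal.ofReal (Real.exp (-(k * |x|))) = ENNReal.ofReal (1 / k) := by
    rw [← h1, ← (Measure.measurePreserving_neg (volume : Measure ℝ)).setLIntegral_comp_preimage_emb
          (MeasurableEquiv.neg ℝ).measurableEmbedding _ (Ioi 0)]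
    simp
  rw [← lintegral_add_compl _ (measurableSet_Ioi (a := (0:ℝ))), h1, compl_Ioi,
    setLIntegral_congr (Iio_ae_eq_Iic (a := (0:ℝ))).symm, h2, ← ENNReal.ofReal_add (by positivity) (by positivity)]
  congr 1; ring

lemma kap_fin : ∫⁻ z, kap z ≠ ⊤ := by
  unfold kap
  rw [lintegral_lintegral_swap (by unfold rad; fun_prop)]
  have h1 : ∀ t ∈ Ioi (0:ℝ), ∫⁻ z, ENNReal.ofReal (Real.exp (-(rad z * Real.cosh t))) ≤ ENNReal.ofReal (64 * Real.exp (-(2 * t))) := by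
    intro t _
    have hc := Real.cosh_pos t
    calc _ ≤ ∫⁻ z : ℝ × ℝ, ENNReal.ofReal (Real.exp (-(Real.cosh t / 2 * |z.1|))) * ENNReal.ofReal (Real.exp (-(Real.cosh t / 2 * |z.2|))) := by
          refine lintegral_mono fun z => ?_
          rw [← ENNReal.ofReal_mul (Real.exp_pos _).le, ← Real.exp_add]
          apply ENNReal.ofReal_le_ofReal
          apply Real.exp_le_exp.2
          have e1 : |z.1| ≤ rad z := Real.abs_le_sqrt (by nlinarith [sq_nonneg z.2])
          have e2 : |z.2| ≤ rad z := Real.abs_le_sqrt (by nlinarith [sq_nonneg z.1])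
          nlinarith
      _ = ENNReal.ofReal (2 / (Real.cosh t / 2)) * ENNReal.ofReal (2 / (Real.cosh t / 2)) := by
          rw [Measure.volume_eq_prod, lintegral_prod_mul (f := fun x : ℝ => ENNReal.ofReal (Real.exp (-(Real.cosh t / 2 * |x|))))
            (g := fun x : ℝ => ENNReal.ofReal (Real.exp (-(Real.cosh t / 2 * |x|)))) (by fun_prop) (by fun_prop), lint_exp_abs _ (by positivity)]
      _ ≤ _ := by
          rw [← ENNReal.ofReal_mul (by positivity)]
          apply ENNReal.ofReal_le_ofReal
          have e3 : Real.exp t / 2 ≤ Real.cosh t := by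
            rw [Real.cosh_eq]; linarith [Real.exp_pos (-t)]
          have e4 : 2 / (Real.cosh t / 2) ≤ 8 * Real.exp (-t) := by
            rw [div_le_iff₀ (by positivity)]
            have : Real.exp (-t) * Real.exp t = 1 := by rw [← Real.exp_add]; simp
            nlinarith [Real.exp_pos (-t)]
          calc _ ≤ (8 * Real.exp (-t)) * (8 * Real.exp (-t)) := mul_le_mul e4 e4 (by positivity) (by positivity)
            _ = _ := by
              rw [show -(2 * t) = -t + -t by ring, Real.exp_add]; ring
  refine ne_top_of_le_ne_top ?_ (setLIntegral_mono' measurableSet_Ioi h1)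
  have hi : IntegrableOn (fun t : ℝ => 64 * Real.exp (-(2 * t))) (Ioi 0) := by
    have := (exp_neg_integrableOn_Ioi 0 (show (0:ℝ) < 2 by norm_num)).const_mul 64
    simpa [IntegrableOn] using this
  rw [← ofReal_integral_eq_lintegral_ofReal hi (ae_of_all _ fun x => by positivity)]
  exact ENNReal.ofReal_ne_top

lemma UHP_meas : MeasurableSet UHP := measurableSet_lt measurable_const measurable_snd

lemma restrict_UHP : (volume : Measure (ℝ × ℝ)).restrict UHP = (volume : Measure ℝ).prod (volume.restrict (Ioi (0:ℝ))) := by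
  have : UHP = univ ×ˢ Ioi (0:ℝ) := by ext x; simp [UHP]
  rw [this, Measure.volume_eq_prod, ← Measure.prod_restrict, Measure.restrict_univ]

lemma uhp_lint (f : ℝ × ℝ → ENNReal) (hf : Measurable f) :
    ∫⁻ x in UHP, f x = ∫⁻ x₂ in Ioi (0:ℝ), ∫⁻ x₁, f (x₁, x₂) := by
  rw [restrict_UHP, lintegral_prod_symm' _ hf]

lemma GUHP_meas : Measurable (fun p : (ℝ × ℝ) × (ℝ × ℝ) => GUHP p.1 p.2) := by
  simp only [GUHP_eq]
  exact prof_meas' (by fun_prop) (by fun_prop) (by fun_prop)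

/-- Energy as a Lebesgue integral -/
noncomputable def En (f : ℝ × ℝ → ℝ) : ENNReal :=
  ∫⁻ x, ∫⁻ y, ENNReal.ofReal (f x) * (ENNReal.ofReal (f y) * ENNReal.ofReal (GUHP x y))

lemma lint_UHP_of_zero (φ : ℝ × ℝ → ENNReal) (h : ∀ x ∉ UHP, φ x = 0) : ∫⁻ x in UHP, φ x = ∫⁻ x, φ x := by
  rw [← lintegral_indicator UHP_meas]
  refine lintegral_congr fun x => ?_
  by_cases hx : x ∈ UHP
  · rw [indicator_of_mem hx]
  · rw [indicator_of_notMem hx, h x hx]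

lemma ae_snd_ne (c : ℝ) : ∀ᵐ y : ℝ × ℝ, y.2 ≠ c := by
  have h0 : ∀ᵐ t : ℝ, t ≠ c := by simp [ae_iff]
  exact (Measure.quasiMeasurePreserving_snd (μ := (volume : Measure ℝ)) (ν := (volume : Measure ℝ))).ae h0

/-- potential as a Lebesgue integral -/
noncomputable def Hp (f : ℝ × ℝ → ℝ) (x : ℝ × ℝ) : ENNReal :=
  ∫⁻ y, ENNReal.ofReal (f y) * ENNReal.ofReal (GUHP x y)

lemma Hp_meas (f : ℝ × ℝ → ℝ) (hf : Measurable f) : Measurable (Hp f) := by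
  have hGm := GUHP_meas
  refine Measurable.lintegral_prod_right' (ν := (volume : Measure (ℝ × ℝ)))
      (f := fun p : (ℝ × ℝ) × (ℝ × ℝ) => ENNReal.ofReal (f p.2) * ENNReal.ofReal (GUHP p.1 p.2)) ?_
  fun_prop

lemma GUHP_meas_right (x : ℝ × ℝ) : Measurable (fun y => GUHP x y) := by
  simp only [GUHP_eq]
  exact prof_meas' (by fun_prop) (by fun_prop) (by fun_prop)

lemma En_eq (f : ℝ × ℝ → ℝ) (hf : Measurable f) : En f = ∫⁻ x, ENNReal.ofReal (f x) * Hp f x := by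
  unfold En Hp
  refine lintegral_congr fun x => ?_
  have := GUHP_meas_right x
  rw [lintegral_const_mul _ (by fun_prop)]

lemma Gop_eq (f : ℝ × ℝ → ℝ) (hf : Measurable f) (hf0 : ∀ x, 0 ≤ f x) (hz : ∀ x ∉ UHP, f x = 0)
    (x : ℝ × ℝ) (hx : x ∈ UHP) : Gop f x = (Hp f x).toReal := by
  have := GUHP_meas_right x
  unfold Gop Hp
  have hnn : 0 ≤ᵐ[volume.restrict UHP] fun y => GUHP x y * f y := by
    refine (ae_restrict_iff' UHP_meas).2 ?_
    filter_upwards [ae_snd_ne x.2] with y hy hyU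
    rw [GUHP_eq]
    exact mul_nonneg (prof_nonneg _ _ hx hyU hy.symm _) (hf0 y)
  rw [integral_eq_lintegral_of_nonneg_ae hnn (Measurable.aestronglyMeasurable (by fun_prop)),
    lint_UHP_of_zero _ (fun y hy => by rw [hz y hy, mul_zero, ENNReal.ofReal_zero])]
  refine congrArg ENNReal.toReal (lintegral_congr fun y => ?_)
  rw [ENNReal.ofReal_mul' (hf0 y), mul_comm]

lemma kineticE_eq (f : ℝ × ℝ → ℝ) (hf : Measurable f) (hf0 : ∀ x, 0 ≤ f x) (hz : ∀ x ∉ UHP, f x = 0)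
    (hE : En f ≠ ⊤) : kineticE f = 1 / 2 * (En f).toReal := by
  have hHm := Hp_meas f hf
  have hG := Gop_eq f hf hf0 hz
  rw [En_eq f hf] at hE ⊢
  unfold kineticE
  refine congrArg (fun t : ℝ => 1 / 2 * t) ?_
  generalize Hp f = H at *
  have h1 : ∫ x in UHP, f x * Gop f x = ∫ x in UHP, f x * (H x).toReal :=
    setIntegral_congr_fun UHP_meas (fun x hx => by rw [hG x hx])
  rw [h1,
    integral_eq_lintegral_of_nonneg_ae (ae_of_all _ fun x => mul_nonneg (hf0 x) ENNReal.toReal_nonneg)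
      (Measurable.aestronglyMeasurable (by fun_prop)),
    lint_UHP_of_zero _ (fun y hy => by rw [hz y hy, zero_mul, ENNReal.ofReal_zero])]
  refine congrArg ENNReal.toReal (lintegral_congr_ae ?_)
  filter_upwards [ae_lt_top (by fun_prop) hE] with x hx
  rw [ENNReal.ofReal_mul (hf0 x)]
  by_cases h0 : ENNReal.ofReal (f x) = 0
  · rw [h0, zero_mul, zero_mul]
  · rw [ENNReal.ofReal_toReal]
    intro hc
    rw [hc, ENNReal.mul_top h0] at hx
    exact lt_irrefl _ hx

lemma En_slices (f : ℝ × ℝ → ℝ) (hf : Measurable f) :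
    En f = ∫⁻ x₂, ∫⁻ y₂, ∫⁻ x₁, ∫⁻ y₁, ENNReal.ofReal (f (x₁, x₂)) * 
      (ENNReal.ofReal (f (y₁, y₂)) * ENNReal.ofReal (prof x₂ y₂ (x₁ - y₁))) := by
  have hGm := GUHP_meas
  unfold En
  have hΦ : Measurable (fun p : (ℝ × ℝ) × (ℝ × ℝ) => ENNReal.ofReal (f p.1) * (ENNReal.ofReal (f p.2) * ENNReal.ofReal (GUHP p.1 p.2))) := by
    fun_prop
  rw [Measure.volume_eq_prod, lintegral_prod_symm' _ (Measurable.lintegral_prod_right' (ν := (volume : Measure ℝ).prod (volume : Measure ℝ)) hΦ)]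
  refine lintegral_congr fun x₂ => ?_
  have hin : ∀ x₁ : ℝ, (∫⁻ y, ENNReal.ofReal (f (x₁, x₂)) * (ENNReal.ofReal (f y) * ENNReal.ofReal (GUHP (x₁, x₂) y))
      ∂((volume : Measure ℝ).prod (volume : Measure ℝ))) = ∫⁻ y₂, ∫⁻ y₁, ENNReal.ofReal (f (x₁, x₂)) *
      (ENNReal.ofReal (f (y₁, y₂)) * ENNReal.ofReal (prof x₂ y₂ (x₁ - y₁))) := by
    intro x₁
    have h1 : Measurable (fun y : ℝ × ℝ => ENNReal.ofReal (f (x₁, x₂)) * (ENNReal.ofReal (f y) * ENNReal.ofReal (GUHP (x₁, x₂) y))) :=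
      hΦ.comp (by fun_prop : Measurable (fun y : ℝ × ℝ => ((x₁, x₂), y)))
    rw [lintegral_prod_symm' _ h1]
    simp only [GUHP_eq]
  have hsw : Measurable (fun q : ℝ × ℝ => ∫⁻ y₁, ENNReal.ofReal (f (q.1, x₂)) *
      (ENNReal.ofReal (f (y₁, q.2)) * ENNReal.ofReal (prof x₂ q.2 (q.1 - y₁)))) := by
    refine Measurable.lintegral_prod_right' (ν := (volume : Measure ℝ))
      (f := fun p : (ℝ × ℝ) × ℝ => ENNReal.ofReal (f (p.1.1, x₂)) * 
      (ENNReal.ofReal (f (p.2, p.1.2)) * ENNReal.ofReal (prof x₂ p.1.2 (p.1.1 - p.2)))) ?_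
    have hp : Measurable (fun p : (ℝ × ℝ) × ℝ => prof x₂ p.1.2 (p.1.1 - p.2)) :=
      prof_meas' (by fun_prop) (by fun_prop) (by fun_prop)
    fun_prop
  refine (lintegral_congr hin).trans ?_
  exact lintegral_lintegral_swap hsw.aemeasurable

set_option maxHeartbeats 1000000 in
lemma En_mono (w : ℝ × ℝ → ℝ) (hw : Measurable w) (hz : ∀ x ∉ UHP, w x = 0)
    (hfin : ∀ x₂, ∫⁻ x₁, ENNReal.ofReal (w (x₁, x₂)) ≠ ⊤) : En w ≤ En (steiner w) := by
  have hs := steiner_measurable w hw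
  rw [En_slices w hw, En_slices _ hs]
  refine lintegral_mono fun x₂ => lintegral_mono_ae ?_
  have h0 : ∀ᵐ t : ℝ, t ≠ x₂ := by simp [ae_iff]
  filter_upwards [h0] with y₂ hy
  by_cases hx2 : 0 < x₂
  swap
  · have : ∀ x₁, w (x₁, x₂) = 0 := fun x₁ => hz _ hx2
    simp [this]
  by_cases hy2 : 0 < y₂
  swap
  · have : ∀ x₁, w (x₁, y₂) = 0 := fun x₁ => hz _ hy2
    simp [this]
  refine riesz_fun (fun x₁ => w (x₁, x₂)) (fun x₁ => w (x₁, y₂)) _ _ (prof x₂ y₂) (by fun_prop) (by fun_prop) 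
    (by fun_prop) (by fun_prop) ?_ (steiner_level w hw x₂ (hfin x₂)) (steiner_level w hw y₂ (hfin y₂)) ?_
  · exact prof_meas' measurable_const measurable_const measurable_id
  · exact fun d d' h => prof_anti x₂ y₂ hx2 hy2 hy.symm d d' h

lemma En_fin (f : ℝ × ℝ → ℝ) (hf : Measurable f) (h2 : ∫⁻ x, ENNReal.ofReal (f x) ^ 2 ≠ ⊤) : En f ≠ ⊤ := by
  have hk := kap_meas
  have h1 : En f ≤ ∫⁻ x, ∫⁻ y, (ENNReal.ofReal (f x) ^ 2 * kap (x - y) + ENNReal.ofReal (f y) ^ 2 * kap (x - y)) := by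
    refine lintegral_mono fun x => lintegral_mono fun y => ?_
    rw [← mul_assoc, ← add_mul]
    refine mul_le_mul' ?_ (GUHP_le x y)
    rcases le_total (ENNReal.ofReal (f x)) (ENNReal.ofReal (f y)) with h | h
    · refine le_trans ?_ le_add_self
      rw [pow_two]; gcongr
    · refine le_trans ?_ le_self_add
      rw [pow_two]; gcongr
  refine ne_top_of_le_ne_top ?_ h1
  have hm : Measurable (fun p : (ℝ × ℝ) × (ℝ × ℝ) => ENNReal.ofReal (f p.1) ^ 2 * kap (p.1 - p.2)) := by fun_prop
  have hm' : Measurable (fun p : (ℝ × ℝ) × (ℝ × ℝ) => ENNReal.ofReal (f p.2) ^ 2 * kap (p.1 - p.2)) := by fun_prop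
  have e1 : ∀ x : ℝ × ℝ, ∫⁻ y, (ENNReal.ofReal (f x) ^ 2 * kap (x - y) + ENNReal.ofReal (f y) ^ 2 * kap (x - y)) =
      (∫⁻ y, ENNReal.ofReal (f x) ^ 2 * kap (x - y)) + ∫⁻ y, ENNReal.ofReal (f y) ^ 2 * kap (x - y) := by
    intro x
    rw [lintegral_add_left (by fun_prop)]
  simp only [e1]
  rw [lintegral_add_left (Measurable.lintegral_prod_right' hm)]
  refine ENNReal.add_ne_top.2 ⟨?_, ?_⟩
  · have : ∀ x : ℝ × ℝ, ∫⁻ y, ENNReal.ofReal (f x) ^ 2 * kap (x - y) = ENNReal.ofReal (f x) ^ 2 * ∫⁻ z, kap z := by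
      intro x
      rw [lintegral_const_mul _ (by fun_prop), lintegral_sub_left_eq_self (fun z => kap z) x]
    simp only [this]
    rw [lintegral_mul_const _ (by fun_prop)]
    exact ENNReal.mul_ne_top h2 kap_fin
  · rw [lintegral_lintegral_swap hm'.aemeasurable]
    have : ∀ y : ℝ × ℝ, ∫⁻ x, ENNReal.ofReal (f y) ^ 2 * kap (x - y) = ENNReal.ofReal (f y) ^ 2 * ∫⁻ z, kap z := by
      intro x
      rw [lintegral_const_mul _ (by fun_prop), lintegral_sub_right_eq_self (fun z => kap z) x]
    simp only [this]
    rw [lintegral_mul_const _ (by fun_prop)]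
    exact ENNReal.mul_ne_top h2 kap_fin

lemma kineticE_congr (f g : ℝ × ℝ → ℝ) (h : f =ᵐ[volume.restrict UHP] g) : kineticE f = kineticE g := by
  have hG : ∀ x, Gop f x = Gop g x := fun x => integral_congr_ae (by
    filter_upwards [h] with y hy; rw [hy])
  unfold kineticE
  congr 1
  refine integral_congr_ae ?_
  filter_upwards [h] with y hy; rw [hy, hG]

/-- good representative -/
lemma good_rep (ω : ℝ × ℝ → ℝ) (hω : NonnegL1L2 ω) : ∃ w : ℝ × ℝ → ℝ, Measurable w ∧ (∀ x, 0 ≤ w x) ∧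
    (∀ x ∉ UHP, w x = 0) ∧ (∀ x₂, ∫⁻ x₁, ENNReal.ofReal (w (x₁, x₂)) ≠ ⊤) ∧ w =ᵐ[volume.restrict UHP] ω := by
  obtain ⟨h0, h1, -⟩ := hω
  set g := h1.aestronglyMeasurable.mk ω with hg
  have hgm : Measurable g := h1.aestronglyMeasurable.stronglyMeasurable_mk.measurable
  have hgω : ω =ᵐ[volume.restrict UHP] g := h1.aestronglyMeasurable.ae_eq_mk
  set w1 : ℝ × ℝ → ℝ := fun x => max (g x) 0 with hw1
  have hw1m : Measurable w1 := by fun_prop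
  have hw1ω : w1 =ᵐ[volume.restrict UHP] ω := by
    filter_upwards [hgω, ae_restrict_mem UHP_meas] with x hx hxU
    simp only [hw1]
    rw [← hx, max_eq_left (h0 x hxU)]
  set J : ℝ → ENNReal := fun x₂ => ∫⁻ x₁, ENNReal.ofReal (w1 (x₁, x₂)) with hJ
  have hJm : Measurable J := by
    refine Measurable.lintegral_prod_right' (ν := (volume : Measure ℝ)) 
      (f := fun p : ℝ × ℝ => ENNReal.ofReal (w1 (p.2, p.1))) (by fun_prop)
  have hJfin : ∀ᵐ x₂ ∂(volume.restrict (Ioi (0:ℝ))), J x₂ < ⊤ := by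
    refine ae_lt_top hJm ?_
    rw [hJ, ← uhp_lint (fun x => ENNReal.ofReal (w1 x)) (by fun_prop)]
    have hi : Integrable w1 (volume.restrict UHP) := Integrable.congr h1 hw1ω.symm
    exact hi.lintegral_lt_top.ne
  have hJfin' : ∀ᵐ x ∂(volume.restrict UHP), J x.2 < ⊤ := by
    rw [restrict_UHP]
    exact Measure.quasiMeasurePreserving_snd.ae hJfin
  have hSm : MeasurableSet {x : ℝ × ℝ | 0 < x.2 ∧ J x.2 < ⊤} :=
    UHP_meas.inter (measurableSet_lt (f := fun x : ℝ × ℝ => J x.2) (g := fun _ => ⊤) (by fun_prop) (by fun_prop))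
  refine ⟨{x : ℝ × ℝ | 0 < x.2 ∧ J x.2 < ⊤}.indicator w1, hw1m.indicator hSm, ?_, ?_, ?_, ?_⟩
  · exact fun x => indicator_nonneg (fun x _ => le_max_right _ _) x
  · intro x hx
    exact indicator_of_notMem (fun h => hx h.1) _
  · intro x₂
    by_cases h : 0 < x₂ ∧ J x₂ < ⊤
    · have : ∀ x₁, {x : ℝ × ℝ | 0 < x.2 ∧ J x.2 < ⊤}.indicator w1 (x₁, x₂) = w1 (x₁, x₂) := fun x₁ =>
        indicator_of_mem (show (x₁, x₂) ∈ {x : ℝ × ℝ | 0 < x.2 ∧ J x.2 < ⊤} from h) _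
      simp only [this]
      exact h.2.ne
    · have : ∀ x₁, {x : ℝ × ℝ | 0 < x.2 ∧ J x.2 < ⊤}.indicator w1 (x₁, x₂) = 0 := fun x₁ =>
        indicator_of_notMem (show (x₁, x₂) ∉ {x : ℝ × ℝ | 0 < x.2 ∧ J x.2 < ⊤} from h) _
      simp [this]
  · filter_upwards [hw1ω, hJfin', ae_restrict_mem UHP_meas] with x h1 h2 h3
    rw [← h1]
    exact indicator_of_mem (show x ∈ {x : ℝ × ℝ | 0 < x.2 ∧ J x.2 < ⊤} from ⟨h3, h2⟩) _

lemma stmt3_aux (ω : ℝ × ℝ → ℝ) (hω : NonnegL1L2 ω) :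
    ∃ ωs : ℝ × ℝ → ℝ, (∀ x ∈ UHP, 0 ≤ ωs x) ∧ SteinerSym ωs ∧
      (∀ s : ℝ, 1 ≤ s → s ≤ 2 → normLs s ωs = normLs s ω) ∧
      normL1 (fun x => x.2 * ωs x) = normL1 (fun x => x.2 * ω x) ∧
      kineticE ω ≤ kineticE ωs := by
  obtain ⟨w, hw, hw0, hz, hfin, hae⟩ := good_rep ω hω
  have hs := steiner_measurable w hw
  have hzs : ∀ x ∉ UHP, steiner w x = 0 := by
    rintro ⟨x₁, x₂⟩ hx
    exact steiner_zero w x₁ x₂ (fun x => hz (x, x₂) hx)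
  have hp : ∀ p : ℝ, 0 < p → ∫⁻ x in UHP, ENNReal.ofReal (steiner w x ^ p) = ∫⁻ x in UHP, ENNReal.ofReal (w x ^ p) := by
    intro p hp
    rw [uhp_lint _ (by fun_prop), uhp_lint _ (by fun_prop)]
    exact lintegral_congr fun x₂ => steiner_lintegral_rpow w hw hw0 x₂ (hfin x₂) p hp
  refine ⟨steiner w, fun x _ => steiner_nonneg w x, ⟨steiner_even w, fun x₂ _ => steiner_anti w hw x₂ (hfin x₂)⟩, ?_, ?_, ?_⟩
  · intro s hs1 _
    unfold normLs
    congr 1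
    have e : ∫ x in UHP, |ω x| ^ s = ∫ x in UHP, w x ^ s := by
      refine integral_congr_ae ?_
      filter_upwards [hae] with x hx
      rw [← hx, abs_of_nonneg (hw0 x)]
    simp only [abs_of_nonneg (steiner_nonneg w _)]
    rw [e, integral_eq_lintegral_of_nonneg_ae (ae_of_all _ fun x => Real.rpow_nonneg (steiner_nonneg w x) s) 
        (Measurable.aestronglyMeasurable (by fun_prop)),
      integral_eq_lintegral_of_nonneg_ae (ae_of_all _ fun x => Real.rpow_nonneg (hw0 x) s) 
        (Measurable.aestronglyMeasurable (by fun_prop)), hp s (by linarith)]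
  · unfold normL1
    have e : ∫ x in UHP, |x.2 * ω x| = ∫ x in UHP, |x.2 * w x| := by
      refine integral_congr_ae ?_
      filter_upwards [hae] with x hx
      rw [← hx]
    rw [e, integral_eq_lintegral_of_nonneg_ae (ae_of_all _ fun x => abs_nonneg _) 
        (Measurable.aestronglyMeasurable (by fun_prop)),
      integral_eq_lintegral_of_nonneg_ae (ae_of_all _ fun x => abs_nonneg _) 
        (Measurable.aestronglyMeasurable (by fun_prop))]
    congr 1
    rw [uhp_lint _ (by fun_prop), uhp_lint _ (by fun_prop)]
    refine lintegral_congr fun x₂ => ?_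
    have h1 := steiner_lintegral_rpow w hw hw0 x₂ (hfin x₂) 1 one_pos
    simp only [Real.rpow_one] at h1
    simp only [abs_mul, abs_of_nonneg (steiner_nonneg w _), abs_of_nonneg (hw0 _), ENNReal.ofReal_mul (abs_nonneg _)]
    rw [lintegral_const_mul _ (by fun_prop), lintegral_const_mul _ (by fun_prop), h1]
  · have h2 : ∫⁻ x, ENNReal.ofReal (steiner w x) ^ 2 ≠ ⊤ := by
      rw [← lint_UHP_of_zero _ (fun x hx => by simp [hzs x hx])]
      have h3 := hp 2 two_pos
      simp only [Real.rpow_two] at h3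
      simp only [← ENNReal.ofReal_pow (steiner_nonneg w _)]
      rw [h3]
      have hi : Integrable (fun x => w x ^ 2) (volume.restrict UHP) := by
        refine Integrable.congr hω.2.2 ?_
        filter_upwards [hae] with x hx
        rw [hx]
      exact hi.lintegral_lt_top.ne
    have hEs := En_fin _ hs h2
    have hle := En_mono w hw hz hfin
    rw [kineticE_congr ω w hae.symm, kineticE_eq w hw hw0 hz (ne_top_of_le_ne_top hEs hle),
      kineticE_eq _ hs (steiner_nonneg w) hzs hEs]
    have := ENNReal.toReal_mono hEs hle
    linarith

end helpers

/-- existence of the Steiner symmetrization. -/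
theorem stmt3 (ω : ℝ × ℝ → ℝ) (hω : NonnegL1L2 ω)
    (hx2 : IntegrableOn (fun x => x.2 * ω x) UHP) :
    ∃ ωs : ℝ × ℝ → ℝ, (∀ x ∈ UHP, 0 ≤ ωs x) ∧ SteinerSym ωs ∧
      (∀ s : ℝ, 1 ≤ s → s ≤ 2 → normLs s ωs = normLs s ω) ∧
      normL1 (fun x => x.2 * ωs x) = normL1 (fun x => x.2 * ω x) ∧
      kineticE ω ≤ kineticE ωs := by
  exact stmt3_aux ω hω
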